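/- For every r ≥ 2 and every integer k ≥ 1, let N_r be the r × r integer matrix whose first row is (1, −(m^k+2), m^k+1, −(m^k+1), ..., (−1)^{r−3}(m^k+1)), whose second row is (1, −(m^k+1), m^k, −m^k, ..., (−1)^{r−3}m^k), and whose remaining rows form the shifted identity pattern (row i+2 has a 1 in column i+1 and zeros elsewhere, for 1 ≤ i ≤ r−2). Then det(N_r) = 1 and det(m^k N_r + Id) = 1; in particular M = m^k N_r + Id lies in GL_r(ℤ) and det(M − Id) = m^{rk} ≠ 0. -/

import Mathlib

/-- The `r × r` integer matrix `N_r` whose first row is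
`(1, -(m^k+2), m^k+1, -(m^k+1), …, (-1)^{r-1}(m^k+1))` (the entry in column `j ≥ 2` being
`(-1)^j (m^k+1)`), whose second row is `(1, -(m^k+1), m^k, -m^k, …, (-1)^{r-1} m^k)` (the
entry in column `j ≥ 2` being `(-1)^j m^k`), and whose remaining rows form the shifted
identity pattern: row `i` (for `i ≥ 2`) has a `1` in column `i - 1` and zeros elsewhere. -/
def Nmat (r m k : ℕ) : Matrix (Fin r) (Fin r) ℤ :=
  Matrix.of fun i j =>
    if (i : ℕ) = 0 then
      if (j : ℕ) = 0 then 1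
      else if (j : ℕ) = 1 then -((m : ℤ) ^ k + 2)
      else (-1) ^ (j : ℕ) * ((m : ℤ) ^ k + 1)
    else if (i : ℕ) = 1 then
      if (j : ℕ) = 0 then 1
      else if (j : ℕ) = 1 then -((m : ℤ) ^ k + 1)
      else (-1) ^ (j : ℕ) * (m : ℤ) ^ k
    else if (j : ℕ) + 1 = (i : ℕ) then 1 else 0

/-- The matrix `x • N_r + y • 1` with its last diagonal shift `y` replaced by `z`. -/
def shiftedNmat (n m k : ℕ) (x y z : ℤ) : Matrix (Fin (n + 3)) (Fin (n + 3)) ℤ :=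
  Matrix.of fun i j =>
    x * Nmat (n + 3) m k i j +
      if (i : ℕ) = (j : ℕ) then (if (i : ℕ) = n + 2 then z else y) else 0

lemma shiftedNmat_self (n m k : ℕ) (x y : ℤ) :
    shiftedNmat n m k x y y = x • Nmat (n + 3) m k + y • 1 := by
  ext i j
  simp only [shiftedNmat, Matrix.of_apply, Matrix.add_apply, Matrix.smul_apply, smul_eq_mul,
    Matrix.one_apply, Fin.ext_iff]
  split_ifs <;> ring

lemma shiftedNmat_submatrix_last (n m k : ℕ) (x y z : ℤ) :
    (shiftedNmat (n + 1) m k x y z).submatrix (Fin.last (n + 3)).succAbove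
      (Fin.last (n + 3)).succAbove = shiftedNmat n m k x y y := by
  ext i j
  have hi : (i : ℕ) ≠ n + 3 := i.isLt.ne
  simp [shiftedNmat, Nmat, hi]

lemma shiftedNmat_submatrix_penultimate (n m k : ℕ) (x y z : ℤ) :
    (shiftedNmat (n + 1) m k x y z).submatrix (Fin.last (n + 3)).succAbove
      (Fin.last (n + 2)).castSucc.succAbove =
      (shiftedNmat n m k x y 0).updateCol (Fin.last (n + 2))
        ((-1 : ℤ) • fun i => shiftedNmat n m k x y 0 i (Fin.last (n + 2))) := by
  ext i j
  have hi : (i : ℕ) < n + 3 := i.isLt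
  induction j using Fin.lastCases with
  | last =>
    have h₁ : (i : ℕ) ≠ n + 3 := hi.ne
    have h₂ : n + 3 + 1 ≠ (i : ℕ) := by omega
    have h₃ : n + 2 + 1 ≠ (i : ℕ) := by omega
    simp only [Matrix.submatrix_apply, Fin.succAbove_last, Fin.succAbove_castSucc_self,
      Matrix.updateCol_self, Pi.smul_apply, shiftedNmat, Nmat, Matrix.of_apply, Fin.val_castSucc,
      Fin.val_succ, Fin.val_last, h₁, h₂, h₃, if_false, smul_eq_mul]
    split_ifs <;> first | contradiction | omega | ring1
  | cast j =>
    have hj : (j : ℕ) < n + 2 := j.isLt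
    have hlt : j.castSucc.castSucc < (Fin.last (n + 2)).castSucc := by
      simp [Fin.lt_def]
    rw [Matrix.updateCol_ne (Fin.castSucc_lt_last j).ne, Matrix.submatrix_apply,
      Fin.succAbove_of_castSucc_lt _ _ hlt]
    simp only [shiftedNmat, Nmat, Matrix.of_apply, Fin.succAbove_last, Fin.val_castSucc]
    split_ifs <;> omega

lemma det_shiftedNmat_succ (n m k : ℕ) (x y z : ℤ) :
    (shiftedNmat (n + 1) m k x y z).det =
      x * (shiftedNmat n m k x y 0).det + z * (shiftedNmat n m k x y y).det := by
  rw [Matrix.det_succ_row _ (Fin.last (n + 3)), Fin.sum_univ_castSucc, Fin.sum_univ_castSucc,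
    Finset.sum_eq_zero, shiftedNmat_submatrix_last, shiftedNmat_submatrix_penultimate,
    Matrix.det_updateCol_smul, Matrix.updateCol_eq_self]
  · have h₁ : shiftedNmat (n + 1) m k x y z (Fin.last (n + 3)) (Fin.last (n + 2)).castSucc = x := by
      simp [shiftedNmat, Nmat]
    have h₂ : shiftedNmat (n + 1) m k x y z (Fin.last (n + 3)) (Fin.last (n + 3)) = z := by
      simp [shiftedNmat, Nmat]
    have h₃ : (-1 : ℤ) ^ (n + 3 + (n + 2)) = -1 := Odd.neg_one_pow ⟨n + 2, by ring⟩
    have h₄ : (-1 : ℤ) ^ (n + 3 + (n + 3)) = 1 := Even.neg_one_pow ⟨n + 3, rfl⟩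
    rw [h₁, h₂]
    simp only [Fin.val_last, Fin.val_castSucc, h₃, h₄]
    ring
  · intro j _
    have hj : (j : ℕ) < n + 2 := j.isLt
    have h : shiftedNmat (n + 1) m k x y z (Fin.last (n + 3)) j.castSucc.castSucc = 0 := by
      simp only [shiftedNmat, Nmat, Matrix.of_apply, Fin.val_last, Fin.val_castSucc]
      split_ifs <;> first | contradiction | omega
    rw [h]
    ring

lemma det_shiftedNmat_zero (m k : ℕ) (x y z : ℤ) :
    (shiftedNmat 0 m k x y z).det =
      x ^ 3 - x ^ 2 * y * m ^ k + z * (x ^ 2 - x * y * m ^ k + y ^ 2) := by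
  rw [Matrix.det_fin_three]
  simp [shiftedNmat, Nmat]
  ring

lemma det_shiftedNmat_last_zero (n m k : ℕ) (x y : ℤ) :
    (shiftedNmat n m k x y 0).det = x ^ n * (x ^ 3 - x ^ 2 * y * m ^ k) := by
  induction n with
  | zero => rw [det_shiftedNmat_zero]; ring
  | succ n ih => rw [det_shiftedNmat_succ, ih]; ring

theorem det_Nmat (r m k : ℕ) (hr : 2 ≤ r) : (Nmat r m k).det = 1 := by
  obtain rfl | ⟨n, rfl⟩ : r = 2 ∨ ∃ n, r = n + 3 := by
    rcases hr.eq_or_lt with h | h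
    · exact .inl h.symm
    · exact .inr ⟨r - 3, by omega⟩
  · rw [Matrix.det_fin_two]
    simp [Nmat]
  · have h := det_shiftedNmat_last_zero n m k 1 0
    rw [shiftedNmat_self] at h
    simpa using h

theorem det_pow_smul_Nmat_add_one (r m k : ℕ) (hr : 2 ≤ r) :
    (((m : ℤ) ^ k) • Nmat r m k + 1).det = 1 := by
  obtain rfl | ⟨n, rfl⟩ : r = 2 ∨ ∃ n, r = n + 3 := by
    rcases hr.eq_or_lt with h | h
    · exact .inl h.symm
    · exact .inr ⟨r - 3, by omega⟩
  · rw [Matrix.det_fin_two]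
    simp [Nmat]
    ring
  · have h : (shiftedNmat n m k ((m : ℤ) ^ k) 1 1).det = 1 := by
      induction n with
      | zero => rw [det_shiftedNmat_zero]; ring
      | succ n ih =>
        rw [det_shiftedNmat_succ, det_shiftedNmat_last_zero, ih (by omega)]
        ring
    rwa [shiftedNmat_self, one_smul] at h

/-- `det(N_r) = 1`, `det(m^k N_r + Id) = 1`, so `M = m^k N_r + Id ∈ GL_r(ℤ)`, and
`det(M - Id) = m^{rk} ≠ 0`. -/
theorem nmat_dets (r m k : ℕ) (hr : 2 ≤ r) (hm : 2 ≤ m) (hk : 1 ≤ k) :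
    (Nmat r m k).det = 1 ∧
      (((m : ℤ) ^ k) • Nmat r m k + 1).det = 1 ∧
        IsUnit (((m : ℤ) ^ k) • Nmat r m k + 1).det ∧
          ((((m : ℤ) ^ k) • Nmat r m k + 1) - 1).det = (m : ℤ) ^ (r * k) ∧
            ((m : ℤ) ^ (r * k) : ℤ) ≠ 0 := by
  have h := det_pow_smul_Nmat_add_one r m k hr
  refine ⟨det_Nmat r m k hr, h, h ▸ isUnit_one, ?_, pow_ne_zero _ (by omega)⟩
  rw [add_sub_cancel_right, Matrix.det_smul, det_Nmat r m k hr, Fintype.card_fin, mul_one,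
    ← pow_mul, mul_comm]
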